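/- arXiv:2112.00375 — 2 statements merged into one kernel-verified Lean document; each statement's English description precedes it below -/
import Mathlib

section
/- Fix η > 0, β ≥ 0, α < 0 and L > 0, and let p̄ : ℝ → ℝ be defined by p̄(x) = −1/α + μ₊ e^{ν₊ x} + μ₋ e^{ν₋ x}, where ν₊ = (β + √(β² − 4ηα))/(2η), ν₋ = (β − √(β² − 4ηα))/(2η), μ₋ = (1/α)·(e^{ν₊ L} − 1)/(e^{ν₊ L} − e^{ν₋ L}) and μ₊ = 1/α − μ₋. Then 0 ≤ p̄(x) ≤ −1/α for every x ∈ [0,L]. -/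
open Set

/-- On `[0, L]` the graph of `x ↦ exp (ν * x)` lies below its chord. -/
theorem exp_mul_le_chord {L x : ℝ} (hL : 0 < L) (hx : x ∈ Icc 0 L) (ν : ℝ) :
    Real.exp (ν * x) ≤ (1 - x / L) + x / L * Real.exp (ν * L) := by
  have h0 : 0 ≤ x / L := div_nonneg hx.1 hL.le
  have h1 : 0 ≤ 1 - x / L := sub_nonneg.2 ((div_le_one hL).2 hx.2)
  have h := convexOn_exp.2 (mem_univ 0) (mem_univ (ν * L)) h1 h0 (by ring)
  have e : x / L * (ν * L) = ν * x := by field_simp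
  simpa [e] using h

theorem stationary_solution_bounds
    (η β α L : ℝ) (hη : 0 < η) (hβ : 0 ≤ β) (hα : α < 0) (hL : 0 < L)
    (νp νm μp μm : ℝ)
    (hνp : νp = (β + Real.sqrt (β ^ 2 - 4 * η * α)) / (2 * η))
    (hνm : νm = (β - Real.sqrt (β ^ 2 - 4 * η * α)) / (2 * η))
    (hμm : μm = (1 / α) * (Real.exp (νp * L) - 1) / (Real.exp (νp * L) - Real.exp (νm * L)))
    (hμp : μp = 1 / α - μm)
    (pbar : ℝ → ℝ)
    (hpbar : pbar = fun x => -1 / α + μp * Real.exp (νp * x) + μm * Real.exp (νm * x)) :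
    ∀ x ∈ Icc 0 L, 0 ≤ pbar x ∧ pbar x ≤ -1 / α := by
  intro x hx
  have hsqrt : β < Real.sqrt (β ^ 2 - 4 * η * α) :=
    Real.lt_sqrt_of_sq_lt (by nlinarith [mul_neg_of_pos_of_neg hη hα])
  have hνp_pos : 0 < νp := hνp ▸ div_pos (by linarith) (by linarith)
  have hνm_neg : νm < 0 := hνm ▸ div_neg_of_neg_of_pos (by linarith) (by linarith)
  have hP : 1 < Real.exp (νp * L) := Real.one_lt_exp_iff.2 (mul_pos hνp_pos hL)
  have hM : Real.exp (νm * L) < 1 := Real.exp_lt_one_iff.2 (mul_neg_of_neg_of_pos hνm_neg hL)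
  have hchord_p := exp_mul_le_chord hL hx νp
  have hchord_m := exp_mul_le_chord hL hx νm
  set P := Real.exp (νp * L)
  set M := Real.exp (νm * L)
  have hPM : 0 < P - M := by linarith
  have hα' : 1 / α < 0 := one_div_neg.2 hα
  have hμm_nonpos : μm ≤ 0 := by
    rw [hμm]
    exact div_nonpos_of_nonpos_of_nonneg
      (mul_nonpos_of_nonpos_of_nonneg hα'.le (by linarith)) hPM.le
  have hμm_mul : μm * (P - M) = 1 / α * (P - 1) := by
    rw [hμm, div_mul_cancel₀ _ hPM.ne']
  have hμp_nonpos : μp ≤ 0 := by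
    have h : μp * (P - M) = 1 / α * (1 - M) := by
      rw [hμp, sub_mul, hμm_mul]; ring
    have h' : 1 / α * (1 - M) < 0 := mul_neg_of_neg_of_pos hα' (by linarith)
    by_contra! hc
    linarith [mul_pos hc hPM]
  have hp := mul_le_mul_of_nonpos_left hchord_p hμp_nonpos
  have hm := mul_le_mul_of_nonpos_left hchord_m hμm_nonpos
  -- The boundary values vanish, so the chord of `pbar` over `[0, L]` is zero.
  have hchord : -1 / α + μp * ((1 - x / L) + x / L * P) + μm * ((1 - x / L) + x / L * M) = 0 := by
    rw [neg_div, hμp]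
    linear_combination (-(x / L)) * hμm_mul
  rw [hpbar]
  refine ⟨by dsimp only; linarith, ?_⟩
  have h1 := mul_nonpos_of_nonpos_of_nonneg hμp_nonpos (Real.exp_pos (νp * x)).le
  have h2 := mul_nonpos_of_nonpos_of_nonneg hμm_nonpos (Real.exp_pos (νm * x)).le
  dsimp only
  linarith
end

section
/- Fix η > 0, β ≥ 0, α < 0 and L > 0, and let p̄ : ℝ → ℝ be defined by p̄(x) = −1/α + μ₊ e^{ν₊ x} + μ₋ e^{ν₋ x}, where ν₊ = (β + √(β² − 4ηα))/(2η), ν₋ = (β − √(β² − 4ηα))/(2η), μ₋ = (1/α)·(e^{ν₊ L} − 1)/(e^{ν₊ L} − e^{ν₋ L}) and μ₊ = 1/α − μ₋. Then p̄(x) > 0 for every x ∈ (0,L). -/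
open Set

theorem Real.exp_mul_lt_chord {ν L x : ℝ} (hν : ν ≠ 0) (hx : x ∈ Ioo 0 L) :
    Real.exp (ν * x) < (1 - x / L) + x / L * Real.exp (ν * L) := by
  have hL : 0 < L := hx.1.trans hx.2
  have h0 : 0 < x / L := div_pos hx.1 hL
  have h1 : 0 < 1 - x / L := sub_pos.2 ((div_lt_one hL).2 hx.2)
  have h := strictConvexOn_exp.2 (mem_univ 0) (mem_univ (ν * L))
    (mul_ne_zero hν hL.ne').symm h1 h0 (by ring)
  have e : x / L * (ν * L) = ν * x := by field_simp
  simpa [smul_eq_mul, e] using h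

theorem stationary_solution_pos
    (η β α L : ℝ) (hη : 0 < η) (hβ : 0 ≤ β) (hα : α < 0) (hL : 0 < L)
    (νp νm μp μm : ℝ)
    (hνp : νp = (β + Real.sqrt (β ^ 2 - 4 * η * α)) / (2 * η))
    (hνm : νm = (β - Real.sqrt (β ^ 2 - 4 * η * α)) / (2 * η))
    (hμm : μm = (1 / α) * (Real.exp (νp * L) - 1) / (Real.exp (νp * L) - Real.exp (νm * L)))
    (hμp : μp = 1 / α - μm)
    (pbar : ℝ → ℝ)
    (hpbar : pbar = fun x => -1 / α + μp * Real.exp (νp * x) + μm * Real.exp (νm * x)) :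
    ∀ x ∈ Ioo 0 L, 0 < pbar x := by
  intro x hx
  have hsqrt : β < Real.sqrt (β ^ 2 - 4 * η * α) :=
    Real.lt_sqrt_of_sq_lt (by nlinarith [mul_pos hη (neg_pos.2 hα)])
  have hνp_pos : 0 < νp := by
    rw [hνp]
    exact div_pos (by linarith) (by linarith)
  have hνm_neg : νm < 0 := by
    rw [hνm]
    exact div_neg_of_neg_of_pos (by linarith) (by linarith)
  have ha : 1 < Real.exp (νp * L) := Real.one_lt_exp_iff.2 (mul_pos hνp_pos hL)
  have hb : Real.exp (νm * L) < 1 := Real.exp_lt_one_iff.2 (mul_neg_of_neg_of_pos hνm_neg hL)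
  have hp := Real.exp_mul_lt_chord hνp_pos.ne' hx
  have hm := Real.exp_mul_lt_chord hνm_neg.ne hx
  subst hpbar hμp hμm
  clear hνp hνm
  beta_reduce
  generalize Real.exp (νp * L) = a at *
  generalize Real.exp (νm * L) = b at *
  generalize Real.exp (νp * x) = u at *
  generalize Real.exp (νm * x) = v at *
  have hab : 0 < a - b := by linarith
  have hweights : (1 - b) * u + (a - 1) * v < a - b := by
    have h1 := mul_lt_mul_of_pos_left hp (sub_pos.2 hb)
    have h2 := mul_lt_mul_of_pos_left hm (sub_pos.2 ha)
    linear_combination h1 + h2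
  have hfactor : -1 / α + (1 / α - 1 / α * (a - 1) / (a - b)) * u + 1 / α * (a - 1) / (a - b) * v
      = (a - b - ((1 - b) * u + (a - 1) * v)) / (-α * (a - b)) := by
    have := hα.ne
    have := hab.ne'
    field_simp
    ring
  rw [hfactor]
  exact div_pos (sub_pos.2 hweights) (mul_pos (neg_pos.2 hα) hab)
end
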